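/- Let 0 < κ_S < κ'_S with max_i (R_i − c_i) > κ'_S, and fix an inspection cost κ_I > 0. For κ ∈ {κ_S, κ'_S}, let F_κ := {γ ∈ (0,1] : u_h(γ) ≥ κ} and U^κ(γ) := (1−γ)ρ(γ) − β_κ(γ)·κ_I. If γ* maximizes U^{κ_S} over F_{κ_S} and the maximum of U^{κ'_S} over F_{κ'_S} is attained, then there exists a maximizer γ'' of U^{κ'_S} over F_{κ'_S} with γ'' ≥ γ*. In words: when the agent's cost of complying with safety measures increases, the optimal payment share weakly increases. -/

import Mathlib

/-- The upper envelope function `u_h(γ) = max_j (γ R_j - c_j)`. -/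
noncomputable def uh (n : ℕ) (hn : 0 < n) (R c : Fin n → ℝ) (γ : ℝ) : ℝ :=
  Finset.univ.sup' (Finset.univ_nonempty_iff.mpr (Fin.pos_iff_nonempty.mp hn))
    (fun j => γ * R j - c j)

/-- The inspection threshold `β_κ(γ) = max{1 - δ_κ(γ)/(γ(1-α)), 0}`. -/
noncomputable def betaFn (α : ℝ) (δ : ℝ → ℝ) (γ : ℝ) : ℝ :=
  max (1 - δ γ / (γ * (1 - α))) 0

theorem le_uh {n : ℕ} (hn : 0 < n) (R c : Fin n → ℝ) (γ : ℝ) (j : Fin n) :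
    γ * R j - c j ≤ uh n hn R c γ :=
  Finset.le_sup' (fun j => γ * R j - c j) (Finset.mem_univ j)

theorem exists_uh_eq {n : ℕ} (hn : 0 < n) (R c : Fin n → ℝ) (γ : ℝ) :
    ∃ j, uh n hn R c γ = γ * R j - c j := by
  obtain ⟨j, -, hj⟩ := Finset.exists_mem_eq_sup'
    (Finset.univ_nonempty_iff.mpr (Fin.pos_iff_nonempty.mp hn)) (fun j => γ * R j - c j)
  exact ⟨j, hj⟩

theorem uh_strictMono {n : ℕ} (hn : 0 < n) {R : Fin n → ℝ} (c : Fin n → ℝ)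
    (hR : ∀ j, 0 < R j) : StrictMono (uh n hn R c) := by
  intro a b hab
  obtain ⟨j, hj⟩ := exists_uh_eq hn R c a
  have h1 := le_uh hn R c b j
  have h2 := mul_lt_mul_of_pos_right hab (hR j)
  linarith

/-- Increments of the upper envelope over a fixed length are monotone. -/
theorem uh_add_le {n : ℕ} (hn : 0 < n) (R c : Fin n → ℝ) {p q t : ℝ} (hqp : q ≤ p)
    (ht : 0 ≤ t) :
    uh n hn R c (q + t) + uh n hn R c p ≤ uh n hn R c q + uh n hn R c (p + t) := by
  obtain ⟨j, hj⟩ := exists_uh_eq hn R c (q + t)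
  obtain ⟨i, hi⟩ := exists_uh_eq hn R c p
  rcases le_total (R j) (R i) with h | h
  · have h1 := le_uh hn R c q j
    have h2 := le_uh hn R c (p + t) i
    nlinarith [mul_nonneg ht (sub_nonneg.2 h)]
  · have h1 := le_uh hn R c q i
    have h2 := le_uh hn R c (p + t) j
    nlinarith [mul_nonneg (sub_nonneg.2 hqp) (sub_nonneg.2 h)]

/-- Equal increments of the upper envelope need shorter intervals further to the right. -/
theorem sub_le_sub_of_uh_sub_eq {n : ℕ} (hn : 0 < n) {R : Fin n → ℝ} (c : Fin n → ℝ)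
    (hR : ∀ j, 0 < R j) {q₁ q₂ p₁ p₂ : ℝ} (hqp : q₁ ≤ p₁) (hp : p₁ ≤ p₂)
    (h : uh n hn R c q₂ - uh n hn R c q₁ = uh n hn R c p₂ - uh n hn R c p₁) :
    p₂ - p₁ ≤ q₂ - q₁ := by
  have h1 := uh_add_le hn R c hqp (sub_nonneg.2 hp)
  rw [add_sub_cancel] at h1
  have h2 : q₁ + (p₂ - p₁) ≤ q₂ := (uh_strictMono hn c hR).le_iff_le.1 (by linarith)
  linarith

theorem max_zero_sub_max_zero_le {x y x' y' : ℝ} (hyx : y ≤ x) (hy : y ≤ y')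
    (h : x - y ≤ x' - y') : max x 0 - max y 0 ≤ max x' 0 - max y' 0 := by
  rcases max_cases x 0 with h1 | h1 <;> rcases max_cases y 0 with h2 | h2 <;>
    rcases max_cases x' 0 with h3 | h3 <;> rcases max_cases y' 0 with h4 | h4 <;> linarith

/-- The drop of the inspection threshold along a payment increase grows as the thresholds
`p` are replaced by lower thresholds `q` that are closer to each other. -/
theorem threshold_drop_le {α γ₁ γ₂ p₁ p₂ q₁ q₂ : ℝ} (hα : α < 1) (hγ₁ : 0 < γ₁)
    (hγ : γ₁ ≤ γ₂) (hpγ : p₁ ≤ γ₁) (hp : γ₂ - γ₁ ≤ p₂ - p₁) (hq₂ : q₂ ≤ p₂)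
    (hpq : p₂ - p₁ ≤ q₂ - q₁) :
    max (1 - p₁ / (γ₁ * (1 - α))) 0 - max (1 - p₂ / (γ₂ * (1 - α))) 0 ≤
      max (1 - q₁ / (γ₁ * (1 - α))) 0 - max (1 - q₂ / (γ₂ * (1 - α))) 0 := by
  have ha : 0 < 1 - α := sub_pos.2 hα
  have hγ₂ : 0 < γ₂ := hγ₁.trans_le hγ
  have hle : γ₁ * (1 - α) ≤ γ₂ * (1 - α) := mul_le_mul_of_nonneg_right hγ ha.le
  have hpos₁ : 0 < γ₁ * (1 - α) := mul_pos hγ₁ ha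
  have hpos₂ : 0 < γ₂ * (1 - α) := mul_pos hγ₂ ha
  apply max_zero_sub_max_zero_le
  · apply sub_le_sub_left
    rw [div_le_div_iff₀ hpos₁ hpos₂, ← mul_assoc, ← mul_assoc]
    refine mul_le_mul_of_nonneg_right ?_ ha.le
    nlinarith [mul_nonneg (sub_nonneg.2 hγ) (sub_nonneg.2 hpγ),
      mul_le_mul_of_nonneg_right hp hγ₁.le]
  · gcongr
  · have h1 : (p₂ - q₂) / (γ₂ * (1 - α)) ≤ (p₁ - q₁) / (γ₁ * (1 - α)) :=
      div_le_div₀ (by linarith) (by linarith) hpos₁ hle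
    rw [sub_div, sub_div] at h1
    linarith

/-- when the safety-compliance cost increases from `κ_S` to
`κ'_S` (with `max_i (R_i - c_i) > κ'_S`), there is a maximizer `γ''` of
`U^{κ'_S}` over `F_{κ'_S}` with `γ'' ≥ γ*`, i.e. the optimal payment share
weakly increases.  Here `F_κ = {γ ∈ (0,1] : u_h(γ) ≥ κ}`,
`U^κ(γ) = (1-γ) ρ(γ) - β_κ(γ) κ_I`, `ρ(γ)` is the largest reward among
maximizers at `γ`, and `δ_κ(γ) ≥ 0` satisfies `u_h(δ_κ(γ)) = u_h(γ) - κ`. -/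
theorem comparative_statics_safety_cost
    (n : ℕ) (hn : 0 < n) (R c : Fin n → ℝ)
    (hc0 : 0 ≤ c ⟨0, hn⟩) (hc : StrictMono c)
    (hR0 : 0 < R ⟨0, hn⟩) (hR : StrictMono R)
    (α : ℝ) (hα0 : 0 < α) (hα1 : α < 1)
    (κS κS' : ℝ) (hκS0 : 0 < κS) (hκ : κS < κS')
    (hA2 : ∃ i : Fin n, κS' < R i - c i)
    (κI : ℝ) (hκI : 0 < κI)
    (δ : ℝ → ℝ → ℝ)
    (hδ : ∀ k : ℝ, 0 < k → ∀ γ ∈ Set.Ioc (0 : ℝ) 1,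
      uh n hn R c 0 ≤ uh n hn R c γ - k →
      0 ≤ δ k γ ∧ uh n hn R c (δ k γ) = uh n hn R c γ - k)
    (ρ : ℝ → ℝ)
    (hρ : ∀ γ : ℝ, (∃ i : Fin n, γ * R i - c i = uh n hn R c γ ∧ ρ γ = R i) ∧
      ∀ i : Fin n, γ * R i - c i = uh n hn R c γ → R i ≤ ρ γ)
    (γstar : ℝ)
    (hγstarF : γstar ∈ Set.Ioc (0 : ℝ) 1 ∧ κS ≤ uh n hn R c γstar)
    (hγstarOpt : ∀ γ ∈ Set.Ioc (0 : ℝ) 1, κS ≤ uh n hn R c γ →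
      (1 - γ) * ρ γ - betaFn α (δ κS) γ * κI ≤
        (1 - γstar) * ρ γstar - betaFn α (δ κS) γstar * κI)
    (hattained : ∃ γ'' ∈ Set.Ioc (0 : ℝ) 1, κS' ≤ uh n hn R c γ'' ∧
      ∀ γ ∈ Set.Ioc (0 : ℝ) 1, κS' ≤ uh n hn R c γ →
        (1 - γ) * ρ γ - betaFn α (δ κS') γ * κI ≤
          (1 - γ'') * ρ γ'' - betaFn α (δ κS') γ'' * κI) :
    ∃ γ'' ∈ Set.Ioc (0 : ℝ) 1, κS' ≤ uh n hn R c γ'' ∧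
      (∀ γ ∈ Set.Ioc (0 : ℝ) 1, κS' ≤ uh n hn R c γ →
        (1 - γ) * ρ γ - betaFn α (δ κS') γ * κI ≤
          (1 - γ'') * ρ γ'' - betaFn α (δ κS') γ'' * κI) ∧
      γstar ≤ γ'' := by
  obtain ⟨g, hg, hgF, hgOpt⟩ := hattained
  rcases le_or_gt γstar g with hle | hlt
  · exact ⟨g, hg, hgF, hgOpt, hle⟩
  obtain ⟨hs, hsF⟩ := hγstarF
  have hfirst : ∀ j : Fin n, (⟨0, hn⟩ : Fin n) ≤ j := fun j => Nat.zero_le j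
  have hRpos : ∀ j, 0 < R j := fun j => hR0.trans_le (hR.monotone (hfirst j))
  have hmono := uh_strictMono hn c hRpos
  have hu0 : uh n hn R c 0 ≤ 0 := by
    obtain ⟨j, hj⟩ := exists_uh_eq hn R c 0
    have := hc.monotone (hfirst j)
    linarith
  have hug := hmono hlt
  have hκS'0 : 0 < κS' := hκS0.trans hκ
  have hp₁ := (hδ κS hκS0 g hg (by linarith)).2
  have hp₂ := (hδ κS hκS0 γstar hs (by linarith)).2
  have hq₁ := (hδ κS' hκS'0 g hg (by linarith)).2
  have hq₂ := (hδ κS' hκS'0 γstar hs (by linarith)).2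
  have hpγ : δ κS g ≤ g := hmono.le_iff_le.1 (by linarith)
  have hq₁p₁ : δ κS' g ≤ δ κS g := hmono.le_iff_le.1 (by linarith)
  have hq₂p₂ : δ κS' γstar ≤ δ κS γstar := hmono.le_iff_le.1 (by linarith)
  have hpp : δ κS g ≤ δ κS γstar := hmono.le_iff_le.1 (by linarith)
  have hβ : betaFn α (δ κS) g - betaFn α (δ κS) γstar ≤
      betaFn α (δ κS') g - betaFn α (δ κS') γstar :=
    threshold_drop_le hα1 hg.1 hlt.le hpγ
      (sub_le_sub_of_uh_sub_eq hn c hRpos hpγ hlt.le (by linarith)) hq₂p₂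
      (sub_le_sub_of_uh_sub_eq hn c hRpos hq₁p₁ hpp (by linarith))
  have hdrop := mul_le_mul_of_nonneg_right hβ hκI.le
  have hopt := hγstarOpt g hg (by linarith)
  refine ⟨γstar, hs, by linarith, fun γ hγ hγF => (hgOpt γ hγ hγF).trans ?_, le_rfl⟩
  linarith
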